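/- Let n = 2t with t ≥ 3 and let E₀, E₁, …, E_{2^t} be 𝔽₂-subspaces of 𝔽₂ⁿ, each of dimension t, with Eᵢ ∩ Eⱼ = {0} for all i ≠ j. Let a, b ∈ 𝔽₂ⁿ with a, b, a+b ∈ E₀^⊥∖{0}. Define f : 𝔽₂ⁿ → 𝔽₂ by f(x) = 1_{E_{2^t}}(x) + (a·x)(b·x) + 1, for 0 ≤ i ≤ r−1 define g_i(x) = ∑_{0 ≤ k ≤ 2^t−1, bit i of k equals 1} 1_{E_k}(x) + 1_{E_{2^t}}(x) + 1 (sums in 𝔽₂) with 2 ≤ r ≤ t, and let F = (f, g₀, …, g_{r−1}) be the (n, r+1)-function. Then the binary linear code C_F is minimal, has length 2ⁿ−1 and exactly 2^{n+r+1} codewords (dimension n+r+1), its minimum nonzero Hamming weight equals 2^{n−2} + 2^{t−1}, and it violates the AB condition: 2·w_min ≤ w_max, where w_min and w_max are the minimum and maximum Hamming weights of nonzero codewords of C_F. -/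

import Mathlib

def dotp {n : ℕ} (v x : Fin n → ZMod 2) : ZMod 2 := ∑ i, v i * x i

def wht {n : ℕ} (f : (Fin n → ZMod 2) → ZMod 2) (ν : Fin n → ZMod 2) : ℤ :=
  ∑ x : Fin n → ZMod 2, (-1 : ℤ) ^ (f x + dotp ν x).val

def whtF {n m : ℕ} (F : (Fin n → ZMod 2) → (Fin m → ZMod 2))
    (μ : Fin m → ZMod 2) (ν : Fin n → ZMod 2) : ℤ :=
  wht (fun x => dotp μ (F x)) ν

def cw {n m : ℕ} (F : (Fin n → ZMod 2) → (Fin m → ZMod 2))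
    (μ : Fin m → ZMod 2) (ν : Fin n → ZMod 2) :
    {x : Fin n → ZMod 2 // x ≠ 0} → ZMod 2 :=
  fun x => dotp μ (F x.1) + dotp ν x.1

def codeF {n m : ℕ} (F : (Fin n → ZMod 2) → (Fin m → ZMod 2)) :
    Set ({x : Fin n → ZMod 2 // x ≠ 0} → ZMod 2) :=
  Set.range fun p : (Fin m → ZMod 2) × (Fin n → ZMod 2) => cw F p.1 p.2

def wt {n : ℕ} (c : {x : Fin n → ZMod 2 // x ≠ 0} → ZMod 2) : ℕ :=
  (Finset.univ.filter fun x => c x = 1).card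

def IsMinimal {n : ℕ} (C : Set ({x : Fin n → ZMod 2 // x ≠ 0} → ZMod 2)) : Prop :=
  ∀ c ∈ C, ∀ c' ∈ C, c ≠ 0 → c' ≠ 0 →
    {x | c' x = 1} ⊆ {x | c x = 1} → c' = c

def weights {n m : ℕ} (F : (Fin n → ZMod 2) → (Fin m → ZMod 2)) : Set ℕ :=
  {w | ∃ c ∈ codeF F, c ≠ 0 ∧ wt c = w}

def dualS {n : ℕ} (E : Submodule (ZMod 2) (Fin n → ZMod 2)) : Set (Fin n → ZMod 2) :=
  {ν | ∀ x ∈ E, dotp ν x = 0}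

def chi (u : ZMod 2) : ℤ := if u = 0 then 1 else -1

lemma chi_add (u v : ZMod 2) : chi (u + v) = chi u * chi v := by
  revert u v; decide

lemma chi_zero : chi 0 = 1 := by decide

lemma chi_eq (u : ZMod 2) : chi u = 1 - 2 * (if u = 1 then 1 else 0) := by
  revert u; decide

lemma zmod2_ne_zero (u : ZMod 2) (h : u ≠ 0) : u = 1 := by
  revert u; decide

lemma zmod2_add_self (u : ZMod 2) : u + u = 0 := by
  revert u; decide

lemma chi_mul (u v : ZMod 2) : 2 * chi (u * v) = 1 + chi u + chi v - chi (u + v) := by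
  revert u v; decide

lemma dotp_add_left {n : ℕ} (u v x : Fin n → ZMod 2) : dotp (u + v) x = dotp u x + dotp v x := by
  simp [dotp, add_mul, Finset.sum_add_distrib]

lemma dotp_add_right {n : ℕ} (u x y : Fin n → ZMod 2) : dotp u (x + y) = dotp u x + dotp u y := by
  simp [dotp, mul_add, Finset.sum_add_distrib]

lemma dotp_zero_left {n : ℕ} (x : Fin n → ZMod 2) : dotp 0 x = 0 := by
  simp [dotp]

lemma dotp_zero_right {n : ℕ} (x : Fin n → ZMod 2) : dotp x 0 = 0 := by
  simp [dotp]

lemma vadd_self {n : ℕ} (u : Fin n → ZMod 2) : u + u = 0 := by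
  funext i; exact zmod2_add_self _

lemma vadd_eq_zero {n : ℕ} {u v : Fin n → ZMod 2} (h : u + v = 0) : u = v := by
  have : u + v + v = v := by rw [h, zero_add]
  rwa [add_assoc, vadd_self, add_zero] at this

open scoped Classical in
lemma wt_eq {n : ℕ} (h : (Fin n → ZMod 2) → ZMod 2) (h0 : h 0 = 0) :
    2 * (wt (fun x : {x : Fin n → ZMod 2 // x ≠ 0} => h x.1) : ℤ) = 2 ^ n - ∑ x, chi (h x) := by
  have hc : wt (fun x : {x : Fin n → ZMod 2 // x ≠ 0} => h x.1)
      = (Finset.univ.filter fun x => h x = 1).card := by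
    unfold wt
    refine Finset.card_bij (fun x _ => x.1) ?_ ?_ ?_
    · intro x hx; simpa using hx
    · intro x _ y _ hxy; exact Subtype.ext hxy
    · intro y hy
      have hy' : h y = 1 := by simpa using hy
      refine ⟨⟨y, ?_⟩, by simpa using hy', rfl⟩
      rintro rfl
      rw [h0] at hy'
      exact absurd hy' (by decide)
  rw [hc]
  simp only [chi_eq, Finset.sum_sub_distrib, ← Finset.mul_sum]
  simp

open scoped Classical in
lemma sum_sub {n : ℕ} (E : Submodule (ZMod 2) (Fin n → ZMod 2)) (ν : Fin n → ZMod 2) :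
    ∑ x, (if x ∈ E then (1 : ℤ) else 0) * chi (dotp ν x)
      = if ν ∈ dualS E then (Nat.card E : ℤ) else 0 := by
  split_ifs with h
  · have : ∀ x, (if x ∈ E then (1 : ℤ) else 0) * chi (dotp ν x) = if x ∈ E then (1 : ℤ) else 0 := by
      intro x
      split_ifs with hx
      · rw [h x hx, chi_zero, one_mul]
      · simp
    simp only [this]
    simp [Nat.card_eq_fintype_card, Fintype.card_subtype]
  · have : ∃ y ∈ E, dotp ν y ≠ 0 := by
      simpa [dualS] using h
    obtain ⟨y, hy, hy1⟩ := this
    have hy1 := zmod2_ne_zero _ hy1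
    have key := Equiv.sum_comp (Equiv.addRight y)
      (fun x => (if x ∈ E then (1 : ℤ) else 0) * chi (dotp ν x))
    have : ∀ x, (if (Equiv.addRight y) x ∈ E then (1 : ℤ) else 0) * chi (dotp ν ((Equiv.addRight y) x))
        = - ((if x ∈ E then (1 : ℤ) else 0) * chi (dotp ν x)) := by
      intro x
      have h1 : (Equiv.addRight y) x = x + y := rfl
      have h2 : x + y ∈ E ↔ x ∈ E := Submodule.add_mem_iff_left _ hy
      rw [h1, dotp_add_right, chi_add, hy1]
      simp only [h2]
      have : chi 1 = -1 := by decide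
      rw [this]; ring
    simp only [this, Finset.sum_neg_distrib] at key
    linarith

lemma exists_dotp {n : ℕ} (ν : Fin n → ZMod 2) (h : ν ≠ 0) : ∃ x, dotp ν x ≠ 0 := by
  obtain ⟨i, hi⟩ := Function.ne_iff.mp h
  refine ⟨Pi.single i 1, ?_⟩
  simpa [dotp, Pi.single_apply] using hi

open scoped Classical in
lemma sum_all {n : ℕ} (ν : Fin n → ZMod 2) :
    ∑ x, chi (dotp ν x) = if ν = 0 then (2 : ℤ) ^ n else 0 := by
  have := sum_sub ⊤ ν
  have h2 : ν ∈ dualS (⊤ : Submodule (ZMod 2) (Fin n → ZMod 2)) ↔ ν = 0 := by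
    constructor
    · intro h
      by_contra h'
      obtain ⟨x, hx⟩ := exists_dotp ν h'
      exact hx (h x trivial)
    · rintro rfl x _
      exact dotp_zero_left x
  simp only [h2] at this
  simpa using this

section spread
variable {t n : ℕ} {E : ℕ → Submodule (ZMod 2) (Fin n → ZMod 2)}

lemma card_E (hdim : ∀ k ≤ 2 ^ t, Module.finrank (ZMod 2) (E k) = t) (k : ℕ) (hk : k ≤ 2 ^ t) :
    Nat.card (E k) = 2 ^ t := by
  have := Module.natCard_eq_pow_finrank (K := ZMod 2) (V := E k)
  rw [this, hdim k hk]; simp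

lemma uniq (hint : ∀ k l, k ≤ 2 ^ t → l ≤ 2 ^ t → k ≠ l → E k ⊓ E l = ⊥)
    {x : Fin n → ZMod 2} (hx : x ≠ 0) {k l : ℕ} (hk : k ≤ 2 ^ t) (hl : l ≤ 2 ^ t)
    (h1 : x ∈ E k) (h2 : x ∈ E l) : k = l := by
  by_contra h
  have : x ∈ E k ⊓ E l := ⟨h1, h2⟩
  rw [hint k l hk hl h] at this
  exact hx (by simpa using this)

open scoped Classical in
lemma cover (hn : n = 2 * t)
    (hdim : ∀ k ≤ 2 ^ t, Module.finrank (ZMod 2) (E k) = t)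
    (hint : ∀ k l, k ≤ 2 ^ t → l ≤ 2 ^ t → k ≠ l → E k ⊓ E l = ⊥)
    {x : Fin n → ZMod 2} (hx : x ≠ 0) : ∃ k ≤ 2 ^ t, x ∈ E k := by
  let A : ℕ → Finset (Fin n → ZMod 2) := fun k => (Finset.univ.filter (· ∈ E k)).erase 0
  have hA : ∀ k ≤ 2 ^ t, (A k).card = 2 ^ t - 1 := by
    intro k hk
    have h := card_E hdim k hk
    rw [Nat.card_eq_fintype_card, Fintype.card_subtype] at h
    simp only [A]
    rw [Finset.card_erase_of_mem (by simp), h]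
  have hU : ((Finset.range (2 ^ t + 1)).biUnion A).card = (2 ^ t + 1) * (2 ^ t - 1) := by
    rw [Finset.card_biUnion]
    · rw [Finset.sum_congr rfl (fun k hk => hA k (by simpa [Nat.lt_succ_iff] using hk))]
      simp
    · intro k hk l hl hkl
      change Disjoint (A k) (A l)
      rw [Finset.disjoint_left]
      intro y hy hy'
      simp only [A, Finset.mem_erase, Finset.mem_filter, Finset.mem_univ, true_and] at hy hy'
      simp only [Finset.coe_range, Finset.mem_range, Nat.lt_succ_iff, Set.mem_Iio] at hk hl
      exact hkl (uniq hint hy.1 hk hl hy.2 hy'.2)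
  have hall : ((Finset.univ : Finset (Fin n → ZMod 2)).erase 0).card = (2 ^ t + 1) * (2 ^ t - 1) := by
    rw [Finset.card_erase_of_mem (by simp)]
    have : 1 ≤ 2 ^ t := Nat.one_le_two_pow
    simp only [Finset.card_univ, Fintype.card_pi, ZMod.card, Finset.prod_const, Fintype.card_fin]
    rw [hn, mul_comm 2 t, pow_mul, ← Nat.sq_sub_sq]
  have hsub : (Finset.range (2 ^ t + 1)).biUnion A ⊆ (Finset.univ : Finset (Fin n → ZMod 2)).erase 0 := by
    intro y hy
    simp only [A, Finset.mem_biUnion, Finset.mem_erase] at hy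
    obtain ⟨k, _, hk, _⟩ := hy
    simp [hk]
  have heq := Finset.eq_of_subset_of_card_le hsub (by rw [hU, hall])
  have : x ∈ (Finset.univ : Finset (Fin n → ZMod 2)).erase 0 := by simp [hx]
  rw [← heq] at this
  simp only [A, Finset.mem_biUnion, Finset.mem_erase, Finset.mem_filter, Finset.mem_range] at this
  obtain ⟨k, h1, _, _, h2⟩ := this
  exact ⟨k, by omega, h2⟩

open scoped Classical in
/-- dual membership indicator -/
noncomputable def T (E : ℕ → Submodule (ZMod 2) (Fin n → ZMod 2)) (ν : Fin n → ZMod 2) (k : ℕ) : ℤ :=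
  if ν ∈ dualS (E k) then 1 else 0

lemma T_nonneg (ν : Fin n → ZMod 2) (k : ℕ) : 0 ≤ T E ν k := by
  unfold T; split_ifs <;> simp

open scoped Classical in
lemma sum_T (hdim : ∀ k ≤ 2 ^ t, Module.finrank (ZMod 2) (E k) = t)
    (ν : Fin n → ZMod 2) (k : ℕ) (hk : k ≤ 2 ^ t) :
    ∑ x, (if x ∈ E k then (1 : ℤ) else 0) * chi (dotp ν x) = 2 ^ t * T E ν k := by
  rw [sum_sub, card_E hdim k hk]
  unfold T
  split_ifs <;> simp

open scoped Classical in
lemma dual_id (hn : n = 2 * t)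
    (hdim : ∀ k ≤ 2 ^ t, Module.finrank (ZMod 2) (E k) = t)
    (hint : ∀ k l, k ≤ 2 ^ t → l ≤ 2 ^ t → k ≠ l → E k ⊓ E l = ⊥)
    (ν : Fin n → ZMod 2) (hν : ν ≠ 0) : ∑ k ∈ Finset.range (2 ^ t + 1), T E ν k = 1 := by
  have h1 : ∀ x : Fin n → ZMod 2, ∑ k ∈ Finset.range (2 ^ t + 1), (if x ∈ E k then (1 : ℤ) else 0)
      = 1 + 2 ^ t * (if x = 0 then 1 else 0) := by
    intro x
    by_cases hx : x = 0
    · subst hx; simp; ring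
    · obtain ⟨k, hk, hxk⟩ := cover hn hdim hint hx
      rw [Finset.sum_eq_single k]
      · simp [hxk, hx]
      · intro l hl hlk
        rw [if_neg]
        intro hxl
        exact hlk (uniq hint hx (by simpa [Nat.lt_succ_iff] using hl) hk hxl hxk)
      · intro h; simp at h; omega
  have h2 : ∑ k ∈ Finset.range (2 ^ t + 1), ∑ x, (if x ∈ E k then (1 : ℤ) else 0) * chi (dotp ν x)
      = 2 ^ t * ∑ k ∈ Finset.range (2 ^ t + 1), T E ν k := by
    rw [Finset.mul_sum]
    exact Finset.sum_congr rfl fun k hk => sum_T hdim ν k (by simpa [Nat.lt_succ_iff] using hk)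
  rw [Finset.sum_comm] at h2
  simp only [← Finset.sum_mul, h1] at h2
  simp only [add_mul, Finset.sum_add_distrib, one_mul] at h2
  rw [sum_all, if_neg hν] at h2
  have h3 : ∑ x : Fin n → ZMod 2, 2 ^ t * (if x = 0 then (1 : ℤ) else 0) * chi (dotp ν x) = 2 ^ t := by
    simp [dotp_zero_right, chi_zero]
  rw [h3] at h2
  have h4 : (2 : ℤ) ^ t ≠ 0 := by positivity
  apply mul_left_cancel₀ h4
  linarith

open scoped Classical in
lemma bent_bound (hn : n = 2 * t) (ht : 3 ≤ t)
    (hdim : ∀ k ≤ 2 ^ t, Module.finrank (ZMod 2) (E k) = t)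
    (hint : ∀ k l, k ≤ 2 ^ t → l ≤ 2 ^ t → k ≠ l → E k ⊓ E l = ⊥)
    (K : Finset ℕ) (hK : K ⊆ Finset.range (2 ^ t + 1)) (hKc : 2 * K.card = 2 ^ t)
    (s : (Fin n → ZMod 2) → ZMod 2) (hs0 : s 0 = 0)
    (hs : ∀ x k, x ≠ 0 → k ≤ 2 ^ t → x ∈ E k → s x = if k ∈ K then 1 else 0)
    (ν : Fin n → ZMod 2) : |∑ x, chi (s x) * chi (dotp ν x)| ≤ 2 ^ t := by
  have hKc' : 2 * (K.card : ℤ) = 2 ^ t := by exact_mod_cast hKc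
  have h1 : ∀ x : Fin n → ZMod 2, chi (s x) = 1 + 2 ^ t * (if x = 0 then 1 else 0)
      - 2 * ∑ k ∈ K, (if x ∈ E k then (1 : ℤ) else 0) := by
    intro x
    by_cases hx : x = 0
    · subst hx; simp [hs0, chi_zero]; linarith
    · obtain ⟨k, hk, hxk⟩ := cover hn hdim hint hx
      have h2 : ∑ l ∈ K, (if x ∈ E l then (1 : ℤ) else 0) = ∑ l ∈ K, (if l = k then (1 : ℤ) else 0) := by
        refine Finset.sum_congr rfl fun l hl => ?_
        have hl' : l ≤ 2 ^ t := by simpa [Nat.lt_succ_iff] using hK hl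
        congr 1
        apply propext
        constructor
        · intro h; exact uniq hint hx hl' hk h hxk
        · rintro rfl; exact hxk
      rw [h2, hs x k hx hk hxk, if_neg hx, Finset.sum_ite_eq', chi_eq]
      split_ifs <;> simp_all
  have h2 : ∑ x, chi (s x) * chi (dotp ν x) = (if ν = 0 then 2 ^ n else 0) + 2 ^ t
      - 2 * (2 ^ t * ∑ k ∈ K, T E ν k) := by
    simp only [h1, sub_mul, add_mul, Finset.sum_sub_distrib, Finset.sum_add_distrib, one_mul]
    rw [sum_all]
    congr 1
    · simp [dotp_zero_right, chi_zero]
    · simp only [mul_assoc, ← Finset.mul_sum, Finset.sum_mul]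
      rw [Finset.sum_comm, Finset.mul_sum K (fun k => T E ν k) ((2 : ℤ) ^ t)]
      congr 1
      exact Finset.sum_congr rfl fun k hk => sum_T hdim ν k (by simpa [Nat.lt_succ_iff] using hK hk)
  rw [h2]
  have hp : (0 : ℤ) < 2 ^ t := by positivity
  by_cases hν : ν = 0
  · subst hν
    have : ∀ k, T E (0 : Fin n → ZMod 2) k = 1 := by
      intro k; unfold T; rw [if_pos]; intro x _; exact dotp_zero_left x
    simp only [this]
    have h4 : (2 : ℤ) ^ n = 2 ^ t * 2 ^ t := by rw [hn, two_mul, pow_add]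
    have h5 : (2 : ℤ) * (2 ^ t * K.card) = 2 ^ t * 2 ^ t := by rw [← hKc']; ring
    simp only [if_true, Finset.sum_const, nsmul_eq_mul, mul_one]
    rw [h4, h5, abs_le]; constructor <;> linarith
  · have h5 : ∑ k ∈ K, T E ν k ≤ 1 := by
      rw [← dual_id hn hdim hint ν hν]
      exact Finset.sum_le_sum_of_subset_of_nonneg hK fun k _ _ => T_nonneg ν k
    have h6 : 0 ≤ ∑ k ∈ K, T E ν k := Finset.sum_nonneg fun k _ => T_nonneg ν k
    rw [if_neg hν, abs_le]; constructor <;> nlinarith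

lemma dual_disj (hn : n = 2 * t)
    (hdim : ∀ k ≤ 2 ^ t, Module.finrank (ZMod 2) (E k) = t)
    (hint : ∀ k l, k ≤ 2 ^ t → l ≤ 2 ^ t → k ≠ l → E k ⊓ E l = ⊥)
    (ν : Fin n → ZMod 2) (hν : ν ≠ 0) (h0 : ν ∈ dualS (E 0)) : ν ∉ dualS (E (2 ^ t)) := by
  intro h1
  have h := dual_id hn hdim hint ν hν
  have h2 : ∑ k ∈ ({0, 2 ^ t} : Finset ℕ), T E ν k ≤ ∑ k ∈ Finset.range (2 ^ t + 1), T E ν k := by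
    refine Finset.sum_le_sum_of_subset_of_nonneg ?_ fun k _ _ => T_nonneg ν k
    intro k hk
    simp only [Finset.mem_insert, Finset.mem_singleton] at hk
    simp only [Finset.mem_range]
    rcases hk with rfl | rfl
    · positivity
    · exact Nat.lt_succ_self _
  rw [h, Finset.sum_pair (by positivity)] at h2
  simp [T, h0, h1] at h2

end spread

lemma half_card (t r : ℕ) (hr : r ≤ t) (μ : Fin r → ZMod 2) (hμ : μ ≠ 0) (c : ZMod 2) :
    2 * ((Finset.range (2 ^ t)).filter
      fun k => ∑ j : Fin r, μ j * (if Nat.testBit k j.1 then 1 else 0) = c).card = 2 ^ t := by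
  obtain ⟨i, hi⟩ := Function.ne_iff.mp hμ
  have hi := zmod2_ne_zero _ hi
  set B : ℕ → ZMod 2 := fun k => ∑ j : Fin r, μ j * (if Nat.testBit k j.1 then 1 else 0) with hB
  have hx : ∀ k, B (k ^^^ 2 ^ i.1) = B k + 1 := by
    intro k
    have : ∀ j : Fin r, μ j * (if Nat.testBit (k ^^^ 2 ^ i.1) j.1 then (1 : ZMod 2) else 0)
        = μ j * (if Nat.testBit k j.1 then 1 else 0) + if j = i then 1 else 0 := by
      intro j
      rw [Nat.testBit_xor, Nat.testBit_two_pow]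
      by_cases hj : j = i
      · subst hj
        rw [hi]
        cases Nat.testBit k j.1 <;> simp <;> decide
      · have : i.1 ≠ j.1 := fun h => hj (Fin.ext h.symm)
        simp [hj, this]
    simp only [hB, this, Finset.sum_add_distrib]
    simp
  have hlt : ∀ k < 2 ^ t, k ^^^ 2 ^ i.1 < 2 ^ t := by
    intro k hk
    exact Nat.xor_lt_two_pow hk (Nat.pow_lt_pow_right (by norm_num) (by omega))
  have h1 : ((Finset.range (2 ^ t)).filter fun k => B k = c).card
      = ((Finset.range (2 ^ t)).filter fun k => ¬ B k = c).card := by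
    refine Finset.card_bij' (fun k _ => k ^^^ 2 ^ i.1) (fun k _ => k ^^^ 2 ^ i.1) ?_ ?_ ?_ ?_
    · intro k hk
      simp only [Finset.mem_filter, Finset.mem_range] at hk ⊢
      refine ⟨hlt k hk.1, ?_⟩
      rw [hx, hk.2]
      clear hk
      revert c; decide
    · intro k hk
      simp only [Finset.mem_filter, Finset.mem_range] at hk ⊢
      refine ⟨hlt k hk.1, ?_⟩
      rw [hx]
      have := hk.2
      revert this
      clear hk
      generalize B k = d
      revert c d; decide
    · intro k _; simp
    · intro k _; simp
  have h2 := Finset.card_filter_add_card_filter_not (s := Finset.range (2 ^ t)) (fun k => B k = c)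
  rw [Finset.card_range] at h2
  change 2 * ((Finset.range (2 ^ t)).filter fun k => B k = c).card = 2 ^ t
  omega

open scoped Classical in
theorem stmt17 (t n r : ℕ) (hn : n = 2 * t) (ht : 3 ≤ t) (hr1 : 2 ≤ r) (hr2 : r ≤ t)
    (E : ℕ → Submodule (ZMod 2) (Fin n → ZMod 2))
    (hdim : ∀ k ≤ 2 ^ t, Module.finrank (ZMod 2) (E k) = t)
    (hint : ∀ k l, k ≤ 2 ^ t → l ≤ 2 ^ t → k ≠ l → E k ⊓ E l = ⊥)
    (a b : Fin n → ZMod 2)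
    (haE : a ∈ dualS (E 0)) (ha0 : a ≠ 0)
    (hbE : b ∈ dualS (E 0)) (hb0 : b ≠ 0)
    (habE : a + b ∈ dualS (E 0)) (hab0 : a + b ≠ 0)
    (f : (Fin n → ZMod 2) → ZMod 2)
    (hf : ∀ x, f x = (if x ∈ E (2 ^ t) then (1 : ZMod 2) else 0)
      + dotp a x * dotp b x + 1)
    (g : Fin r → (Fin n → ZMod 2) → ZMod 2)
    (hg : ∀ (j : Fin r) (x : Fin n → ZMod 2), g j x =
      (∑ k ∈ Finset.range (2 ^ t),
        if Nat.testBit k j.1 then (if x ∈ E k then (1 : ZMod 2) else 0) else 0)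
      + (if x ∈ E (2 ^ t) then (1 : ZMod 2) else 0) + 1)
    (F : (Fin n → ZMod 2) → (Fin (r + 1) → ZMod 2))
    (hF : ∀ x, F x = Fin.cons (f x) (fun j : Fin r => g j x)) :
    IsMinimal (codeF F) ∧
    Nat.card {x : Fin n → ZMod 2 // x ≠ 0} = 2 ^ n - 1 ∧
    Nat.card (codeF F) = 2 ^ (n + r + 1) ∧
    IsLeast (weights F) (2 ^ (n - 2) + 2 ^ (t - 1)) ∧
    (∀ wmin wmax : ℕ, IsLeast (weights F) wmin → IsGreatest (weights F) wmax →
      2 * wmin ≤ wmax) := by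
  classical
  -- numerics
  obtain ⟨Q, hQ⟩ : ∃ Q : ℤ, Q = 2 ^ t := ⟨_, rfl⟩
  have hQ8 : 8 ≤ Q := by
    rw [hQ]
    calc (8 : ℤ) = 2 ^ 3 := by norm_num
      _ ≤ 2 ^ t := pow_le_pow_right₀ (by norm_num) ht
  have hQn : (2 : ℤ) ^ n = Q * Q := by rw [hn, two_mul, pow_add, hQ]
  -- abbreviations
  let B : (Fin r → ZMod 2) → ℕ → ZMod 2 :=
    fun μ k => ∑ j : Fin r, μ j * (if Nat.testBit k j.1 then 1 else 0)
  let w : (Fin r → ZMod 2) → ZMod 2 := fun μ => ∑ j, μ j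
  let P : (Fin r → ZMod 2) → (Fin n → ZMod 2) → ZMod 2 := fun μ x => ∑ j, μ j * g j x
  have hdF : ∀ (μ : Fin (r + 1) → ZMod 2) x,
      dotp μ (F x) = μ 0 * f x + P (fun j => μ j.succ) x := by
    intro μ x
    simp [dotp, hF, Fin.sum_univ_succ, P]
  have hP : ∀ μ x, P μ x = (∑ k ∈ Finset.range (2 ^ t), B μ k * (if x ∈ E k then 1 else 0))
      + w μ * (if x ∈ E (2 ^ t) then 1 else 0) + w μ := by
    intro μ x
    simp only [P, hg, mul_add, Finset.sum_add_distrib, mul_one, w, B, Finset.sum_mul]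
    congr 2
    rw [Finset.sum_comm]
    simp only [Finset.mul_sum]
    refine Finset.sum_congr rfl fun k _ => Finset.sum_congr rfl fun j _ => ?_
    split_ifs <;> simp
  have hf0 : f 0 = 0 := by
    rw [hf]; simp [dotp_zero_right]; decide
  have hPz : ∀ x, P 0 x = 0 := by intro x; simp [P]
  have hP0 : ∀ μ, P μ 0 = 0 := by
    intro μ
    by_cases hμ : μ = 0
    · rw [hμ, hPz]
    have h1 := half_card t r hr2 μ hμ 1
    have h2 : ∑ k ∈ Finset.range (2 ^ t), B μ k
        = (((Finset.range (2 ^ t)).filter fun k => B μ k = 1).card : ZMod 2) := by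
      rw [Finset.card_filter, Nat.cast_sum]
      refine Finset.sum_congr rfl fun k _ => ?_
      generalize B μ k = d
      revert d; decide
    have h3 : ((Finset.range (2 ^ t)).filter fun k => B μ k = 1).card = 2 * 2 ^ (t - 2) := by
      have : 2 ^ t = 2 * (2 * 2 ^ (t - 2)) := by
        rw [← mul_assoc, show 2 * 2 = 2 ^ 2 by norm_num, ← pow_add]; congr 1; omega
      rw [this] at h1
      simp only [B]
      rw [this]
      omega
    rw [hP]
    simp only [Submodule.zero_mem, if_true, mul_one]
    rw [h2, h3, add_assoc, zmod2_add_self, add_zero]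
    push_cast
    rw [show (2 : ZMod 2) = 0 from rfl, zero_mul]
  have hPx : ∀ μ x k, x ≠ 0 → k ≤ 2 ^ t → x ∈ E k →
      P μ x = if k = 2 ^ t then 0 else B μ k + w μ := by
    intro μ x k hx hk hxk
    have hiff : ∀ l ≤ 2 ^ t, (x ∈ E l ↔ l = k) := by
      intro l hl
      constructor
      · intro h; exact uniq hint hx hl hk h hxk
      · rintro rfl; exact hxk
    have h1 : ∑ l ∈ Finset.range (2 ^ t), B μ l * (if x ∈ E l then 1 else 0)
        = ∑ l ∈ Finset.range (2 ^ t), if l = k then B μ l else 0 := by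
      refine Finset.sum_congr rfl fun l hl => ?_
      have hl' := Finset.mem_range.mp hl
      simp only [hiff l hl'.le, mul_ite, mul_one, mul_zero]
    rw [hP, h1, Finset.sum_ite_eq']
    simp only [hiff _ le_rfl, Finset.mem_range]
    by_cases h : k = 2 ^ t
    · subst h; simp [zmod2_add_self]
    · have : k < 2 ^ t := lt_of_le_of_ne hk h
      simp [this, h, Ne.symm h]
  -- Walsh transform
  let W : (Fin (r + 1) → ZMod 2) → (Fin n → ZMod 2) → ℤ :=
    fun μ ν => ∑ x, chi (dotp μ (F x) + dotp ν x)
  have hwt : ∀ μ ν, 2 * (wt (cw F μ ν) : ℤ) = Q * Q - W μ ν := by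
    intro μ ν
    rw [← hQn]
    refine wt_eq (fun x => dotp μ (F x) + dotp ν x) ?_
    simp only [hdF, hf0, hP0, dotp_zero_right]; simp
  have hA : ∀ μ ν, μ 0 = 0 → (μ ≠ 0 ∨ ν ≠ 0) → |W μ ν| ≤ Q := by
    intro μ ν h0 hne
    by_cases hμ : (fun j : Fin r => μ j.succ) = 0
    · have hμ0 : μ = 0 := by
        funext i
        refine Fin.cases h0 (fun j => congrFun hμ j) i
      have hν : ν ≠ 0 := by tauto
      have : W μ ν = 0 := by
        simp only [W, hμ0, dotp_zero_left, zero_add]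
        rw [sum_all, if_neg hν]
      rw [this]; simp; linarith
    · simp only [W, chi_add]
      rw [hQ]
      refine bent_bound hn ht hdim hint
        ((Finset.range (2 ^ t)).filter fun k => B (fun j => μ j.succ) k = w (fun j => μ j.succ) + 1)
        ?_ (half_card t r hr2 _ hμ _) _ ?_ ?_ ν
      · intro k hk
        simp only [Finset.mem_filter, Finset.mem_range] at hk ⊢
        omega
      · rw [hdF, hf0, hP0]; simp
      · intro x k hx hk hxk
        rw [hdF, h0, zero_mul, zero_add, hPx _ x k hx hk hxk]
        simp only [Finset.mem_filter, Finset.mem_range]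
        by_cases h : k = 2 ^ t
        · simp [h]
        · have : k < 2 ^ t := lt_of_le_of_ne hk h
          simp only [h, this, if_false, true_and]
          generalize B (fun j => μ j.succ) k = u
          generalize w (fun j => μ j.succ) = v
          revert u v; decide
  -- the case `μ 0 = 1`
  let s : (Fin r → ZMod 2) → (Fin n → ZMod 2) → ZMod 2 :=
    fun μ x => P μ x + ((if x ∈ E (2 ^ t) then 1 else 0) + 1)
  let S : (Fin r → ZMod 2) → (Fin n → ZMod 2) → ℤ := fun μ ν => ∑ x, chi (s μ x) * chi (dotp ν x)
  have hWS : ∀ μ ν, μ 0 = 1 → 2 * W μ ν = S (fun j => μ j.succ) ν + S (fun j => μ j.succ) (ν + a)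
      + S (fun j => μ j.succ) (ν + b) - S (fun j => μ j.succ) (ν + (a + b)) := by
    intro μ ν h0
    simp only [W, S, Finset.mul_sum, ← Finset.sum_add_distrib, ← Finset.sum_sub_distrib]
    refine Finset.sum_congr rfl fun x _ => ?_
    have h1 : dotp μ (F x) + dotp ν x
        = s (fun j => μ j.succ) x + (dotp a x * dotp b x + dotp ν x) := by
      rw [hdF, h0, hf]; simp only [s]; ring
    rw [h1]
    simp only [dotp_add_left, chi_add]
    have h2 := chi_mul (dotp a x) (dotp b x)
    rw [chi_add] at h2
    linear_combination (chi (s (fun j => μ j.succ) x) * chi (dotp ν x)) * h2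
  have hSb : ∀ μ ν, μ ≠ 0 → |S μ ν| ≤ Q := by
    intro μ ν hμ
    rw [hQ]
    refine bent_bound hn ht hdim hint
        ((Finset.range (2 ^ t)).filter fun k => B μ k = w μ)
        ?_ (half_card t r hr2 _ hμ _) _ ?_ ?_ ν
    · intro k hk
      simp only [Finset.mem_filter, Finset.mem_range] at hk ⊢
      omega
    · simp only [s, hP0, Submodule.zero_mem, if_true]; decide
    · intro x k hx hk hxk
      simp only [s]
      rw [hPx _ x k hx hk hxk]
      simp only [Finset.mem_filter, Finset.mem_range]
      by_cases h : k = 2 ^ t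
      · have : x ∈ E (2 ^ t) := h ▸ hxk
        simp [h, this, zmod2_add_self]
      · have h1 : k < 2 ^ t := lt_of_le_of_ne hk h
        have h2 : x ∉ E (2 ^ t) := fun h' => h (uniq hint hx hk le_rfl hxk h')
        simp only [h, h1, h2, if_false, true_and]
        generalize B μ k = u
        generalize w μ = v
        revert u v; decide
  have hS0 : ∀ ν, S 0 ν = 2 * Q * T E ν (2 ^ t) - (if ν = 0 then Q * Q else 0) := by
    intro ν
    have h1 : ∀ x, chi (s 0 x) = 2 * (if x ∈ E (2 ^ t) then (1 : ℤ) else 0) - 1 := by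
      intro x
      simp only [s, hPz, zero_add]
      split_ifs <;> decide
    simp only [S, h1, sub_mul, Finset.sum_sub_distrib, one_mul, mul_assoc, ← Finset.mul_sum]
    rw [sum_all, sum_T hdim ν _ le_rfl, hQn, hQ]
  have hSn : ∀ ν, ν ∉ dualS (E (2 ^ t)) → S 0 ν = 0 := by
    intro ν h
    have : ν ≠ 0 := by
      rintro rfl
      exact h fun x _ => dotp_zero_left x
    rw [hS0]; simp [T, h, this]
  have hSa : ∀ ν, |S 0 ν| ≤ Q * Q - 2 * Q := by
    intro ν
    rw [hS0]
    unfold T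
    rw [abs_le]
    by_cases h : ν = 0
    · have h' : ν ∈ dualS (E (2 ^ t)) := by
        rw [h]; exact fun x _ => dotp_zero_left x
      simp only [h, h', if_true]
      rw [if_pos (h ▸ h')]
      constructor <;> nlinarith
    · rw [if_neg h]
      split_ifs <;> constructor <;> nlinarith
  have hDadd : ∀ u v, u ∈ dualS (E (2 ^ t)) → v ∈ dualS (E (2 ^ t)) → u + v ∈ dualS (E (2 ^ t)) := by
    intro u v hu hv x hx
    rw [dotp_add_left, hu x hx, hv x hx, add_zero]
  have haD := dual_disj hn hdim hint a ha0 haE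
  have hbD := dual_disj hn hdim hint b hb0 hbE
  have habD := dual_disj hn hdim hint (a + b) hab0 habE
  have hz : (0 : Fin n → ZMod 2) ∈ dualS (E (2 ^ t)) := fun x _ => dotp_zero_left x
  have hC : ∀ μ ν, μ 0 = 1 → |2 * W μ ν| ≤ Q * Q - 2 * Q := by
    intro μ ν h0
    rw [hWS μ ν h0]
    by_cases hμ : (fun j : Fin r => μ j.succ) = 0
    · rw [hμ]
      have e : ∀ u v, ∀ d, d ∉ dualS (E (2 ^ t)) → u + v = d → u ∈ dualS (E (2 ^ t)) →
          S 0 v = 0 := by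
        intro u v d hd huv hu
        refine hSn v fun hv => hd ?_
        rw [← huv]; exact hDadd u v hu hv
      have two : ∀ u : Fin n → ZMod 2, u + u = 0 := vadd_self
      have e01 : ν + (ν + a) = a := by rw [← add_assoc, two, zero_add]
      have e02 : ν + (ν + b) = b := by rw [← add_assoc, two, zero_add]
      have e03 : ν + (ν + (a + b)) = a + b := by rw [← add_assoc, two, zero_add]
      have e12 : (ν + a) + (ν + b) = a + b := by
        rw [show (ν + a) + (ν + b) = (ν + ν) + (a + b) by abel, two, zero_add]
      have e13 : (ν + a) + (ν + (a + b)) = b := by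
        rw [show (ν + a) + (ν + (a + b)) = (ν + ν) + ((a + a) + b) by abel, two, two, zero_add, zero_add]
      have e23 : (ν + b) + (ν + (a + b)) = a := by
        rw [show (ν + b) + (ν + (a + b)) = (ν + ν) + ((b + b) + a) by abel, two, two, zero_add, zero_add]
      by_cases m0 : ν ∈ dualS (E (2 ^ t))
      · rw [e _ _ _ haD e01 m0, e _ _ _ hbD e02 m0, e _ _ _ habD e03 m0]
        simpa using hSa ν
      rw [hSn _ m0]
      by_cases m1 : ν + a ∈ dualS (E (2 ^ t))
      · rw [e _ _ _ habD e12 m1, e _ _ _ hbD e13 m1]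
        simpa using hSa (ν + a)
      rw [hSn _ m1]
      by_cases m2 : ν + b ∈ dualS (E (2 ^ t))
      · rw [e _ _ _ haD e23 m2]
        simpa using hSa (ν + b)
      rw [hSn _ m2]
      have := hSa (ν + (a + b))
      simpa using this
    · have h1 := abs_le.mp (hSb _ ν hμ)
      have h2 := abs_le.mp (hSb _ (ν + a) hμ)
      have h3 := abs_le.mp (hSb _ (ν + b) hμ)
      have h4 := abs_le.mp (hSb _ (ν + (a + b)) hμ)
      rw [abs_le]
      constructor <;> nlinarith
  have hall : ∀ μ ν, (μ ≠ 0 ∨ ν ≠ 0) → |2 * W μ ν| ≤ Q * Q - 2 * Q := by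
    intro μ ν h
    by_cases h0 : μ 0 = 0
    · have := abs_le.mp (hA μ ν h0 h)
      rw [abs_le]
      constructor <;> nlinarith
    · exact hC μ ν (zmod2_ne_zero _ h0)
  -- special codewords
  let μ₁ : Fin (r + 1) → ZMod 2 := Fin.cons 1 0
  have hμ₁ : μ₁ 0 = 1 := rfl
  have hμ₁' : (fun j : Fin r => μ₁ j.succ) = 0 := by funext j; simp [μ₁]
  have hμ₁n : μ₁ ≠ 0 := by
    intro h
    have := congrFun h 0
    rw [hμ₁] at this
    exact one_ne_zero this
  have hSz : S 0 0 = 2 * Q - Q * Q := by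
    rw [hS0]; simp [T, hz]
  have hW0 : 2 * W μ₁ 0 = 2 * Q - Q * Q := by
    rw [hWS _ _ hμ₁, hμ₁', zero_add, zero_add, zero_add, hSn _ haD, hSn _ hbD, hSn _ habD, hSz]
    ring
  have hWab : 2 * W μ₁ (a + b) = Q * Q - 2 * Q := by
    rw [hWS _ _ hμ₁, hμ₁', vadd_self (a + b), show a + b + a = b + (a + a) by abel,
      show a + b + b = a + (b + b) by abel, vadd_self, vadd_self, add_zero, add_zero,
      hSn _ haD, hSn _ hbD, hSn _ habD, hSz]
    ring
  have hcwz : ∀ μ ν, cw F μ ν = 0 → μ = 0 ∧ ν = 0 := by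
    intro μ ν h
    by_contra hne
    have hne' : μ ≠ 0 ∨ ν ≠ 0 := by tauto
    have h1 := abs_le.mp (hall μ ν hne')
    have h2 := hwt μ ν
    rw [h] at h2
    have h3 : wt (0 : {x : Fin n → ZMod 2 // x ≠ 0} → ZMod 2) = 0 := by simp [wt]
    rw [h3] at h2
    push_cast at h2
    nlinarith
  have hcwz' : cw F 0 0 = 0 := by
    funext x; simp [cw, dotp_zero_left]
  have hcadd : ∀ μ ν μ' ν', cw F (μ + μ') (ν + ν') = cw F μ ν + cw F μ' ν' := by
    intro μ ν μ' ν'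
    funext x
    simp only [cw, dotp_add_left, Pi.add_apply]; ring
  have hcself : ∀ c : {x : Fin n → ZMod 2 // x ≠ 0} → ZMod 2, c + c = 0 := by
    intro c; funext x; exact zmod2_add_self _
  have hinj : Function.Injective
      (fun p : (Fin (r + 1) → ZMod 2) × (Fin n → ZMod 2) => cw F p.1 p.2) := by
    rintro ⟨μ, ν⟩ ⟨μ', ν'⟩ h
    simp only at h
    have h1 : cw F (μ + μ') (ν + ν') = 0 := by rw [hcadd, h, hcself]
    obtain ⟨h2, h3⟩ := hcwz _ _ h1
    rw [vadd_eq_zero h2, vadd_eq_zero h3]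
  have hmin4 : 4 * ((2 ^ (n - 2) + 2 ^ (t - 1) : ℕ) : ℤ) = Q * Q + 2 * Q := by
    have h1 : (2 : ℤ) ^ n = 4 * 2 ^ (n - 2) := by
      rw [show (4 : ℤ) = 2 ^ 2 by norm_num, ← pow_add]; congr 1; omega
    have h2 : Q = 2 * 2 ^ (t - 1) := by
      rw [hQ, ← pow_succ']; congr 1; omega
    push_cast
    rw [← hQn, h1]; linarith
  have hleast : IsLeast (weights F) (2 ^ (n - 2) + 2 ^ (t - 1)) := by
    constructor
    · refine ⟨cw F μ₁ (a + b), ⟨(μ₁, a + b), rfl⟩, fun h => hμ₁n (hcwz _ _ h).1, ?_⟩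
      have := hwt μ₁ (a + b)
      zify at hmin4 ⊢
      push_cast at hmin4
      linarith
    · rintro _ ⟨c, ⟨⟨μ, ν⟩, rfl⟩, hc, rfl⟩
      have hne : μ ≠ 0 ∨ ν ≠ 0 := by
        by_contra h
        push Not at h
        apply hc
        simp only [h.1, h.2]
        exact hcwz'
      have h1 := abs_le.mp (hall μ ν hne)
      have h2 := hwt μ ν
      zify
      push_cast at hmin4
      linarith
  refine ⟨?_, ?_, ?_, hleast, ?_⟩
  · rintro _ ⟨⟨μ, ν⟩, rfl⟩ _ ⟨⟨μ', ν'⟩, rfl⟩ hc hc' hsub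
    simp only at hc hc' hsub ⊢
    by_contra hne
    have n1 : μ ≠ 0 ∨ ν ≠ 0 := by
      by_contra h
      push Not at h
      exact hc (by rw [h.1, h.2, hcwz'])
    have n2 : μ' ≠ 0 ∨ ν' ≠ 0 := by
      by_contra h
      push Not at h
      exact hc' (by rw [h.1, h.2, hcwz'])
    have n3 : μ + μ' ≠ 0 ∨ ν + ν' ≠ 0 := by
      by_contra h
      push Not at h
      exact hne (by rw [vadd_eq_zero h.1, vadd_eq_zero h.2])
    have hw : wt (cw F μ ν) = wt (cw F μ' ν') + wt (cw F (μ + μ') (ν + ν')) := by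
      rw [hcadd]
      unfold wt
      simp only [Finset.card_filter]
      rw [← Finset.sum_add_distrib]
      refine Finset.sum_congr rfl fun x _ => ?_
      have hx : cw F μ' ν' x = 1 → cw F μ ν x = 1 := fun h => hsub h
      revert hx
      rw [Pi.add_apply]
      generalize cw F μ ν x = u
      generalize cw F μ' ν' x = v
      revert u v; decide
    have w1 := hwt μ ν
    have w2 := hwt μ' ν'
    have w3 := hwt (μ + μ') (ν + ν')
    rw [hw] at w1
    push_cast at w1
    have key : W μ' ν' + W (μ + μ') (ν + ν') - W μ ν = Q * Q := by linarith
    have b1 := abs_le.mp (hall _ _ n1)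
    have b2 := abs_le.mp (hall _ _ n2)
    have b3 := abs_le.mp (hall _ _ n3)
    by_cases h1 : μ 0 = 0
    · have c1 := abs_le.mp (hA _ _ h1 n1)
      nlinarith
    · by_cases h2 : μ' 0 = 0
      · have c1 := abs_le.mp (hA _ _ h2 n2)
        nlinarith
      · have h3 : (μ + μ') 0 = 0 := by
          rw [Pi.add_apply, zmod2_ne_zero _ h1, zmod2_ne_zero _ h2]; decide
        have c1 := abs_le.mp (hA _ _ h3 n3)
        nlinarith
  · rw [Nat.card_eq_fintype_card, Fintype.card_subtype_compl]
    simp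
  · unfold codeF
    rw [← Set.image_univ, Nat.card_image_of_injective hinj]
    simp [Nat.card_eq_fintype_card, ← pow_add]
    ring
  · intro wmin wmax h1 h2
    have hw1 : wmin ≤ _ := h1.2 hleast.1
    have hw2 : wt (cw F μ₁ 0) ≤ wmax :=
      h2.2 ⟨cw F μ₁ 0, ⟨(μ₁, 0), rfl⟩, fun h => hμ₁n (hcwz _ _ h).1, rfl⟩
    have h3 := hwt μ₁ 0
    zify at hw1 hw2 ⊢
    push_cast at hmin4
    nlinarith
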